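/- arXiv:1610.08208 — 2 statements merged into one kernel-verified Lean document; each statement's English description precedes it below -/
import Mathlib

section
/- The n(2n+3) functions ψ_α (1 ≤ α ≤ n), ψ_{kl}, ψ_{k̄l̄}, ψ̃_{kl}, ψ̃_{k̄l̄} (1 ≤ k < l ≤ n+1), restricted to the unit sphere S^{4n+3} ⊂ ℍ^{n+1}, form an orthonormal system with respect to the L² inner product (f,h) = ∫_{S^{4n+3}} f·h dμ, where μ is the rotation-invariant Borel measure on S^{4n+3} normalized so that μ(S^{4n+3}) = n(2n+3). -/
open scoped BigOperators Quaternion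

/-- Pairs `k < l` of indices in `Fin m`. -/
abbrev SpherePairs (m : ℕ) := {p : Fin m × Fin m // p.1 < p.2}

/-- The constant `c_{n,α}` (with `α` given 1-based). -/
noncomputable def LOc (n α : ℕ) : ℝ :=
  Real.sqrt (((n : ℝ) + 1) * ((n : ℝ) + 1 - α) / ((n : ℝ) * ((n : ℝ) + 2 - α)))

/-- The constant `d_n`. -/
noncomputable def LOd (n : ℕ) : ℝ := Real.sqrt (2 * ((n : ℝ) + 1) / n)

/-- `ψ_α`, for `α : Fin n` representing the 1-based index `α+1`. -/
noncomputable def psiA (n : ℕ) (α : Fin n) (a : Fin (n + 1) → ℍ[ℝ]) : ℝ :=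
  LOc n (α.val + 1) *
    (Quaternion.normSq (a α.castSucc) -
      (1 / ((n : ℝ) - α.val)) *
        ∑ k : Fin (n + 1), if (α.val : ℕ) < k.val then Quaternion.normSq (a k) else 0)

/-- `ψ_{kl} = d_n Re(u_{kl})`, where `conj(a_k)·a_l = u_{kl} + w_{kl}·j`. -/
noncomputable def psiU (n : ℕ) (p : SpherePairs (n + 1)) (a : Fin (n + 1) → ℍ[ℝ]) : ℝ :=
  LOd n * (star (a p.1.1) * a p.1.2).re

/-- `ψ_{k̄l̄} = d_n Im(u_{kl})`. -/
noncomputable def psiUbar (n : ℕ) (p : SpherePairs (n + 1)) (a : Fin (n + 1) → ℍ[ℝ]) : ℝ :=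
  LOd n * (star (a p.1.1) * a p.1.2).imI

/-- `ψ̃_{kl} = d_n Re(w_{kl})`. -/
noncomputable def psiW (n : ℕ) (p : SpherePairs (n + 1)) (a : Fin (n + 1) → ℍ[ℝ]) : ℝ :=
  LOd n * (star (a p.1.1) * a p.1.2).imJ

/-- `ψ̃_{k̄l̄} = d_n Im(w_{kl})`. -/
noncomputable def psiWbar (n : ℕ) (p : SpherePairs (n + 1)) (a : Fin (n + 1) → ℍ[ℝ]) : ℝ :=
  LOd n * (star (a p.1.1) * a p.1.2).imK

/-- Index type for the `n(2n+3)` functions of Lemma 3.2. -/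
abbrev QFamIdx (n : ℕ) :=
  Fin n ⊕ SpherePairs (n + 1) ⊕ SpherePairs (n + 1) ⊕ SpherePairs (n + 1) ⊕ SpherePairs (n + 1)

/-- The family `ψ_α, ψ_{kl}, ψ_{k̄l̄}, ψ̃_{kl}, ψ̃_{k̄l̄}`. -/
noncomputable def qfam (n : ℕ) : QFamIdx n → (Fin (n + 1) → ℍ[ℝ]) → ℝ
  | Sum.inl α => psiA n α
  | Sum.inr (Sum.inl p) => psiU n p
  | Sum.inr (Sum.inr (Sum.inl p)) => psiUbar n p
  | Sum.inr (Sum.inr (Sum.inr (Sum.inl p))) => psiW n p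
  | Sum.inr (Sum.inr (Sum.inr (Sum.inr p))) => psiWbar n p

open MeasureTheory

noncomputable instance : MeasurableSpace ℍ[ℝ] := borel _

open scoped InnerProductSpace

section SphereMoments

variable {E : Type*} [NormedAddCommGroup E] [InnerProductSpace ℝ E] [MeasurableSpace E]
  [BorelSpace E] {ν : Measure E}

/-- A continuous function is integrable against a finite measure carried by the unit sphere. -/
lemma integrable_of_continuous_of_ae_norm_eq_one [FiniteDimensional ℝ E] [IsFiniteMeasure ν]
    (hν : ∀ᵐ x ∂ν, ‖x‖ = 1) {f : E → ℝ} (hf : Continuous f) : Integrable f ν := by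
  obtain ⟨C, hC⟩ := (isCompact_sphere (0 : E) 1).exists_bound_of_continuousOn hf.continuousOn
  refine Integrable.of_bound hf.aestronglyMeasurable C ?_
  filter_upwards [hν] with x hx
  exact hC x (by simpa using hx)

lemma integral_inner_pow_four_congr_norm (hinv : ∀ L : E ≃ₗᵢ[ℝ] E, ν.map L = ν) {u v : E}
    (h : ‖u‖ = ‖v‖) : ∫ x, ⟪u, x⟫_ℝ ^ 4 ∂ν = ∫ x, ⟪v, x⟫_ℝ ^ 4 ∂ν := by
  set L := (ℝ ∙ (v - u))ᗮ.reflection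
  have hL : L v = u := Submodule.reflection_sub h.symm
  conv_rhs => rw [← hinv L]
  rw [integral_map L.continuous.aemeasurable
    (by fun_prop : Continuous fun x : E => ⟪v, x⟫_ℝ ^ 4).aestronglyMeasurable]
  refine integral_congr_ae (Filter.Eventually.of_forall fun x => ?_)
  have : ⟪v, L x⟫_ℝ = ⟪u, x⟫_ℝ := by
    rw [← hL, ← L.inner_map_map (L v) x, Submodule.reflection_reflection]
  simp only [this]

lemma exists_integral_inner_pow_four (hinv : ∀ L : E ≃ₗᵢ[ℝ] E, ν.map L = ν) :
    ∃ K : ℝ, ∀ u : E, ∫ x, ⟪u, x⟫_ℝ ^ 4 ∂ν = K * ‖u‖ ^ 4 := by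
  rcases subsingleton_or_nontrivial E with hE | hE
  · exact ⟨0, fun u => by simp [Subsingleton.elim u 0]⟩
  · obtain ⟨e, he⟩ := exists_norm_eq E zero_le_one
    refine ⟨∫ x, ⟪e, x⟫_ℝ ^ 4 ∂ν, fun u => ?_⟩
    rw [integral_inner_pow_four_congr_norm hinv (v := ‖u‖ • e) (by simp [norm_smul, he])]
    simp_rw [real_inner_smul_left, mul_pow]
    rw [integral_const_mul, mul_comm]

/-- Fourth moments of an isotropic measure carried by the unit sphere. -/
lemma exists_integral_inner_mul_inner [FiniteDimensional ℝ E] [IsFiniteMeasure ν]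
    (hν : ∀ᵐ x ∂ν, ‖x‖ = 1) (hinv : ∀ L : E ≃ₗᵢ[ℝ] E, ν.map L = ν) :
    ∃ κ : ℝ, ∀ a b c d : E, ∫ x, ⟪a, x⟫_ℝ * ⟪b, x⟫_ℝ * (⟪c, x⟫_ℝ * ⟪d, x⟫_ℝ) ∂ν =
      κ * (⟪a, b⟫_ℝ * ⟪c, d⟫_ℝ + ⟪a, c⟫_ℝ * ⟪b, d⟫_ℝ + ⟪a, d⟫_ℝ * ⟪b, c⟫_ℝ) := by
  obtain ⟨K, hK⟩ := exists_integral_inner_pow_four hinv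
  have hKs (u : E) : ∫ x, ⟪u, x⟫_ℝ ^ 4 ∂ν = K * ⟪u, u⟫_ℝ ^ 2 := by
    rw [hK, real_inner_self_eq_norm_sq]; ring
  have hint (u : E) : Integrable (fun x => ⟪u, x⟫_ℝ ^ 4) ν :=
    integrable_of_continuous_of_ae_norm_eq_one hν (by fun_prop)
  refine ⟨K / 3, fun a b c d => ?_⟩
  have hpol : ∀ x : E, ⟪a, x⟫_ℝ * ⟪b, x⟫_ℝ * (⟪c, x⟫_ℝ * ⟪d, x⟫_ℝ) = 1 / 192 *
      (⟪a + b + c + d, x⟫_ℝ ^ 4 - ⟪a + b + c - d, x⟫_ℝ ^ 4 - ⟪a + b - c + d, x⟫_ℝ ^ 4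
        + ⟪a + b - c - d, x⟫_ℝ ^ 4 - ⟪a - b + c + d, x⟫_ℝ ^ 4 + ⟪a - b + c - d, x⟫_ℝ ^ 4
        + ⟪a - b - c + d, x⟫_ℝ ^ 4 - ⟪a - b - c - d, x⟫_ℝ ^ 4) := by
    intro x
    simp only [inner_add_left, inner_sub_left]
    ring
  simp_rw [hpol]
  rw [integral_const_mul, integral_sub (by fun_prop) (hint _), integral_add (by fun_prop) (hint _),
    integral_add (by fun_prop) (hint _), integral_sub (by fun_prop) (hint _),
    integral_add (by fun_prop) (hint _), integral_sub (by fun_prop) (hint _),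
    integral_sub (hint _) (hint _)]
  simp only [hKs]
  simp only [inner_add_left, inner_sub_left, inner_add_right, inner_sub_right,
    real_inner_comm a b, real_inner_comm a c, real_inner_comm a d, real_inner_comm b c,
    real_inner_comm b d, real_inner_comm c d]
  ring

end SphereMoments

lemma EuclideanSpace.exists_integral_mul_sphere {ι : Type*} [Fintype ι] [DecidableEq ι]
    {ν : Measure (EuclideanSpace ℝ ι)} [IsFiniteMeasure ν] (hν : ∀ᵐ x ∂ν, ‖x‖ = 1)
    (hinv : ∀ L : EuclideanSpace ℝ ι ≃ₗᵢ[ℝ] EuclideanSpace ℝ ι, ν.map L = ν) :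
    ∃ κ : ℝ, κ * (Fintype.card ι * (Fintype.card ι + 2)) = ν.real Set.univ ∧
      ∀ i j k l : ι, ∫ x, x i * x j * (x k * x l) ∂ν =
        κ * ((if i = j then 1 else 0) * (if k = l then 1 else 0) +
          (if i = k then 1 else 0) * (if j = l then 1 else 0) +
          (if i = l then 1 else 0) * (if j = k then 1 else 0)) := by
  obtain ⟨κ, hκ⟩ := exists_integral_inner_mul_inner hν hinv
  have hmom : ∀ i j k l : ι, ∫ x, x i * x j * (x k * x l) ∂ν =
        κ * ((if i = j then 1 else 0) * (if k = l then 1 else 0) +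
          (if i = k then 1 else 0) * (if j = l then 1 else 0) +
          (if i = l then 1 else 0) * (if j = k then 1 else 0)) := by
    intro i j k l
    simpa [EuclideanSpace.inner_single_left, PiLp.single_apply] using
      hκ (EuclideanSpace.single i 1) (EuclideanSpace.single j 1) (EuclideanSpace.single k 1)
        (EuclideanSpace.single l 1)
  refine ⟨κ, ?_, hmom⟩
  have h1 : ∫ x, ∑ i, ∑ j, x i * x i * (x j * x j) ∂ν = ν.real Set.univ := by
    rw [← mul_one (ν.real Set.univ), ← smul_eq_mul, ← integral_const]
    refine integral_congr_ae ?_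
    filter_upwards [hν] with x hx
    have h2 : ∑ i, x i * x i = 1 := by
      have := EuclideanSpace.real_norm_sq_eq x
      rw [hx] at this
      simpa [sq] using this.symm
    rw [← Finset.sum_mul_sum, h2, one_mul]
  rw [← h1, integral_finsetSum _ fun i _ =>
    integrable_of_continuous_of_ae_norm_eq_one hν (by fun_prop)]
  have h3 (i : ι) : ∫ x, ∑ j, x i * x i * (x j * x j) ∂ν = κ * (Fintype.card ι + 2) := by
    rw [integral_finsetSum _ fun i _ =>
      integrable_of_continuous_of_ae_norm_eq_one hν (by fun_prop)]
    simp [hmom, ← Finset.mul_sum, Finset.sum_add_distrib]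
    ring_nf
    simp
  simp [h3]
  ring

instance : BorelSpace ℍ[ℝ] := ⟨rfl⟩

section Coordinates

variable {m : ℕ}

/-- The real coordinates of a quaternionic vector. -/
noncomputable def quatCoords (m : ℕ) :
    (Fin m → ℍ[ℝ]) ≃ₗ[ℝ] EuclideanSpace ℝ (Fin m × Fin 4) where
  toFun a := WithLp.toLp 2 fun s => ![(a s.1).re, (a s.1).imI, (a s.1).imJ, (a s.1).imK] s.2
  invFun x k := ⟨x (k, 0), x (k, 1), x (k, 2), x (k, 3)⟩
  map_add' a b := by
    ext ⟨k, c⟩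
    fin_cases c <;> simp
  map_smul' r a := by
    ext ⟨k, c⟩
    fin_cases c <;> simp
  left_inv a := by
    ext k <;> simp
  right_inv x := by
    ext ⟨k, c⟩
    fin_cases c <;> rfl

lemma quatCoords_apply (a : Fin m → ℍ[ℝ]) (k : Fin m) (c : Fin 4) :
    quatCoords m a (k, c) = ![(a k).re, (a k).imI, (a k).imJ, (a k).imK] c :=
  rfl

lemma norm_quatCoords_sq (a : Fin m → ℍ[ℝ]) :
    ‖quatCoords m a‖ ^ 2 = ∑ k, Quaternion.normSq (a k) := by
  rw [EuclideanSpace.real_norm_sq_eq, Fintype.sum_prod_type]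
  simp [quatCoords_apply, Fin.sum_univ_four, Quaternion.normSq_def']

lemma continuous_quatCoords : Continuous (quatCoords m) :=
  (quatCoords m).toLinearMap.continuous_of_finiteDimensional

lemma continuous_quatCoords_apply (s : Fin m × Fin 4) : Continuous fun a => quatCoords m a s :=
  (EuclideanSpace.proj s).continuous.comp continuous_quatCoords

lemma continuous_quatCoords_symm : Continuous (quatCoords m).symm :=
  (quatCoords m).symm.toLinearMap.continuous_of_finiteDimensional

end Coordinates

/-- A measure on quaternionic vectors that is rotation invariant and carried by the unit sphere. -/
structure IsSphereMeasure {m : ℕ} (μ : Measure (Fin m → ℍ[ℝ])) : Prop where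
  isFiniteMeasure : IsFiniteMeasure μ
  ae_eq_one : ∀ᵐ a ∂μ, ∑ k, Quaternion.normSq (a k) = 1
  map_eq : ∀ g : (Fin m → ℍ[ℝ]) →ₗ[ℝ] (Fin m → ℍ[ℝ]),
    (∀ a, ∑ k, Quaternion.normSq (g a k) = ∑ k, Quaternion.normSq (a k)) → μ.map g = μ

namespace IsSphereMeasure

variable {m : ℕ} {μ : Measure (Fin m → ℍ[ℝ])}

lemma ae_norm_eq_one (hμ : IsSphereMeasure μ) : ∀ᵐ x ∂μ.map (quatCoords m), ‖x‖ = 1 := by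
  rw [ae_map_iff continuous_quatCoords.aemeasurable
    (measurableSet_eq_fun measurable_norm measurable_const)]
  filter_upwards [hμ.ae_eq_one] with a ha
  rw [← norm_quatCoords_sq] at ha
  exact (pow_eq_one_iff_of_nonneg (norm_nonneg _) two_ne_zero).1 ha

lemma map_isometry_eq (hμ : IsSphereMeasure μ)
    (L : EuclideanSpace ℝ (Fin m × Fin 4) ≃ₗᵢ[ℝ] EuclideanSpace ℝ (Fin m × Fin 4)) :
    (μ.map (quatCoords m)).map L = μ.map (quatCoords m) := by
  set g := (quatCoords m).symm.toLinearMap ∘ₗ L.toLinearEquiv.toLinearMap ∘ₗ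
    (quatCoords m).toLinearMap with hg
  have hgc : Continuous g :=
    continuous_quatCoords_symm.comp (L.continuous.comp continuous_quatCoords)
  have hgmap : μ.map g = μ := hμ.map_eq g fun a => by
    simp [← norm_quatCoords_sq, hg]
  conv_rhs => rw [← hgmap]
  rw [Measure.map_map L.continuous.measurable continuous_quatCoords.measurable,
    Measure.map_map continuous_quatCoords.measurable hgc.measurable]
  congr 1
  ext a : 1
  simp [hg]

lemma integrable (hμ : IsSphereMeasure μ) {f : (Fin m → ℍ[ℝ]) → ℝ} (hf : Continuous f) :
    Integrable f μ := by
  have := hμ.isFiniteMeasure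
  have h := (integrable_of_continuous_of_ae_norm_eq_one hμ.ae_norm_eq_one
    (hf.comp continuous_quatCoords_symm)).comp_measurable continuous_quatCoords.measurable
  simpa [Function.comp_def] using h

lemma exists_integral_coords_mul (hμ : IsSphereMeasure μ) :
    ∃ κ : ℝ, κ * (4 * m * (4 * m + 2)) = μ.real Set.univ ∧
      ∀ i j k l : Fin m × Fin 4,
        ∫ a, quatCoords m a i * quatCoords m a j * (quatCoords m a k * quatCoords m a l) ∂μ =
        κ * ((if i = j then 1 else 0) * (if k = l then 1 else 0) +
          (if i = k then 1 else 0) * (if j = l then 1 else 0) +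
          (if i = l then 1 else 0) * (if j = k then 1 else 0)) := by
  have := hμ.isFiniteMeasure
  obtain ⟨κ, hκ, h⟩ :=
    EuclideanSpace.exists_integral_mul_sphere hμ.ae_norm_eq_one hμ.map_isometry_eq
  refine ⟨κ, ?_, fun i j k l => ?_⟩
  · rw [map_measureReal_apply continuous_quatCoords.measurable MeasurableSet.univ] at hκ
    rw [← Set.preimage_univ, ← hκ]
    simp [mul_comm]
  · rw [← h, integral_map continuous_quatCoords.aemeasurable
      (by fun_prop : Continuous _).aestronglyMeasurable]

end IsSphereMeasure

/-- The quadratic form `∑ S c d a_{kc} a_{ld}` in the real coordinates of two entries of `a`. -/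
noncomputable def blockForm {m : ℕ} (S : Matrix (Fin 4) (Fin 4) ℝ) (k l : Fin m)
    (a : Fin m → ℍ[ℝ]) : ℝ :=
  ∑ c, ∑ d, S c d * (quatCoords m a (k, c) * quatCoords m a (l, d))

@[fun_prop]
lemma continuous_blockForm {m : ℕ} (S : Matrix (Fin 4) (Fin 4) ℝ) (k l : Fin m) :
    Continuous (blockForm S k l) := by
  unfold blockForm
  exact continuous_finsetSum _ fun c _ => continuous_finsetSum _ fun d _ => continuous_const.mul
    ((continuous_quatCoords_apply _).mul (continuous_quatCoords_apply _))

lemma IsSphereMeasure.exists_integral_blockForm_mul {m : ℕ} {μ : Measure (Fin m → ℍ[ℝ])}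
    (hμ : IsSphereMeasure μ) :
    ∃ κ : ℝ, κ * (4 * m * (4 * m + 2)) = μ.real Set.univ ∧
      ∀ (S T : Matrix (Fin 4) (Fin 4) ℝ) (k l k' l' : Fin m),
        ∫ a, blockForm S k l a * blockForm T k' l' a ∂μ =
        κ * ((if k = l then 1 else 0) * (if k' = l' then 1 else 0) * (S.trace * T.trace) +
          (if k = k' then 1 else 0) * (if l = l' then 1 else 0) * (S * T.transpose).trace +
          (if k = l' then 1 else 0) * (if l = k' then 1 else 0) * (S * T).trace) := by
  obtain ⟨κ, hκ, h⟩ := hμ.exists_integral_coords_mul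
  refine ⟨κ, hκ, fun S T k l k' l' => ?_⟩
  have hint (c d e f : Fin 4) : Integrable (fun a =>
      S c d * (quatCoords m a (k, c) * quatCoords m a (l, d)) *
        (T e f * (quatCoords m a (k', e) * quatCoords m a (l', f)))) μ :=
    hμ.integrable ((continuous_const.mul
      ((continuous_quatCoords_apply _).mul (continuous_quatCoords_apply _))).mul
        (continuous_const.mul
          ((continuous_quatCoords_apply _).mul (continuous_quatCoords_apply _))))
  have hterm (c d e f : Fin 4) :
      ∫ a, S c d * (quatCoords m a (k, c) * quatCoords m a (l, d)) *
        (T e f * (quatCoords m a (k', e) * quatCoords m a (l', f))) ∂μ =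
      S c d * T e f * (κ * ((if (k, c) = (l, d) then 1 else 0) *
          (if (k', e) = (l', f) then 1 else 0) +
        (if (k, c) = (k', e) then 1 else 0) * (if (l, d) = (l', f) then 1 else 0) +
        (if (k, c) = (l', f) then 1 else 0) * (if (l, d) = (k', e) then 1 else 0))) := by
    rw [← h, ← integral_const_mul]
    congr 1 with a
    ring
  have hexp : ∫ a, blockForm S k l a * blockForm T k' l' a ∂μ = ∑ c, ∑ e, ∑ d, ∑ f,
      ∫ a, S c d * (quatCoords m a (k, c) * quatCoords m a (l, d)) *
        (T e f * (quatCoords m a (k', e) * quatCoords m a (l', f))) ∂μ := by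
    simp only [blockForm, Finset.sum_mul_sum]
    rw [integral_finsetSum _ fun c _ => integrable_finsetSum _ fun e _ =>
      integrable_finsetSum _ fun d _ => integrable_finsetSum _ fun f _ => hint c d e f]
    refine Finset.sum_congr rfl fun c _ => ?_
    rw [integral_finsetSum _ fun e _ =>
      integrable_finsetSum _ fun d _ => integrable_finsetSum _ fun f _ => hint c d e f]
    refine Finset.sum_congr rfl fun e _ => ?_
    rw [integral_finsetSum _ fun d _ => integrable_finsetSum _ fun f _ => hint c d e f]
    refine Finset.sum_congr rfl fun d _ => ?_
    rw [integral_finsetSum _ fun f _ => hint c d e f]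
  have hδ (i j : Fin m) (c d : Fin 4) : (if (i, c) = (j, d) then (1 : ℝ) else 0) =
      (if i = j then 1 else 0) * (if c = d then 1 else 0) := by
    simp only [Prod.mk.injEq, ite_and, ite_mul, one_mul, zero_mul]
  rw [hexp]
  simp only [hterm, hδ, Matrix.trace, Matrix.diag, Matrix.mul_apply, Matrix.transpose_apply]
  generalize (if k = l then (1 : ℝ) else 0) = d₁, (if k' = l' then (1 : ℝ) else 0) = d₂,
    (if k = k' then (1 : ℝ) else 0) = d₃, (if l = l' then (1 : ℝ) else 0) = d₄,
    (if k = l' then (1 : ℝ) else 0) = d₅, (if l = k' then (1 : ℝ) else 0) = d₆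
  simp only [mul_add, Finset.sum_add_distrib]
  simp
  simp only [Fin.sum_univ_four]
  ring

/-- The matrix of the bilinear form `(q, p) ↦ (star q * p)_t`, where `t` runs through the real
components of a quaternion. -/
def starMulMatrix : Fin 4 → Matrix (Fin 4) (Fin 4) ℝ :=
  ![1,
    !![0, 1, 0, 0; -1, 0, 0, 0; 0, 0, 0, -1; 0, 0, 1, 0],
    !![0, 0, 1, 0; 0, 0, 0, 1; -1, 0, 0, 0; 0, -1, 0, 0],
    !![0, 0, 0, 1; 0, 0, -1, 0; 0, 1, 0, 0; -1, 0, 0, 0]]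

lemma trace_starMulMatrix_mul_transpose (s t : Fin 4) :
    (starMulMatrix s * (starMulMatrix t).transpose).trace = if s = t then 4 else 0 := by
  simp only [Matrix.trace, Matrix.diag, Matrix.mul_apply, Matrix.transpose_apply,
    Fin.sum_univ_four]
  fin_cases s <;> fin_cases t <;> simp [starMulMatrix] <;> norm_num

lemma normSq_eq_blockForm {m : ℕ} (k : Fin m) (a : Fin m → ℍ[ℝ]) :
    Quaternion.normSq (a k) = blockForm 1 k k a := by
  simp [blockForm, quatCoords_apply, Fin.sum_univ_four, Quaternion.normSq_def', Matrix.one_apply]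
  ring

section Family

variable {n : ℕ} (p : SpherePairs (n + 1)) (a : Fin (n + 1) → ℍ[ℝ])

lemma psiU_eq : psiU n p a = LOd n * blockForm (starMulMatrix 0) p.1.1 p.1.2 a := by
  simp [psiU, blockForm, quatCoords_apply, starMulMatrix, Fin.sum_univ_four, Matrix.one_apply]

lemma psiUbar_eq : psiUbar n p a = LOd n * blockForm (starMulMatrix 1) p.1.1 p.1.2 a := by
  simp [psiUbar, blockForm, quatCoords_apply, starMulMatrix, Fin.sum_univ_four]

lemma psiW_eq : psiW n p a = LOd n * blockForm (starMulMatrix 2) p.1.1 p.1.2 a := by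
  simp [psiW, blockForm, quatCoords_apply, starMulMatrix, Fin.sum_univ_four]

lemma psiWbar_eq : psiWbar n p a = LOd n * blockForm (starMulMatrix 3) p.1.1 p.1.2 a := by
  simp [psiWbar, blockForm, quatCoords_apply, starMulMatrix, Fin.sum_univ_four]

/-- The coefficient of `|a_k|²` in `ψ_α / c_{n,α}`. -/
noncomputable def diagCoeff (α : Fin n) (k : Fin (n + 1)) : ℝ :=
  (if k = α.castSucc then 1 else 0) - if α.castSucc < k then 1 / ((n : ℝ) - α.val) else 0

lemma psiA_eq (α : Fin n) :
    psiA n α a = LOc n (α.val + 1) * ∑ k, diagCoeff α k * blockForm 1 k k a := by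
  simp only [psiA, diagCoeff, normSq_eq_blockForm, sub_mul, Finset.sum_sub_distrib, ite_mul,
    one_mul, zero_mul, Finset.sum_ite_eq', Finset.mem_univ, if_true, mul_ite,
    mul_zero, Finset.mul_sum, Fin.lt_def, Fin.val_castSucc]

end Family

section DiagCoeff

variable {n : ℕ}

lemma Fin.sum_castSucc_lt (α : Fin n) (c : ℝ) :
    ∑ k : Fin (n + 1), (if α.castSucc < k then c else 0) = ((n : ℝ) - α.val) * c := by
  rw [← Finset.sum_filter, Finset.sum_const, nsmul_eq_mul]
  have : (Finset.univ.filter fun k : Fin (n + 1) => α.castSucc < k) = Finset.Ioi α.castSucc := by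
    ext; simp
  rw [this, Fin.card_Ioi, Fin.val_castSucc, Nat.add_sub_cancel, Nat.cast_sub α.2.le]

lemma sub_val_pos (α : Fin n) : (0 : ℝ) < n - α.val := by
  have : (α.val : ℝ) < n := by exact_mod_cast α.2
  linarith

lemma sum_diagCoeff (α : Fin n) : ∑ k, diagCoeff α k = 0 := by
  have := (sub_val_pos α).ne'
  simp only [diagCoeff, Finset.sum_sub_distrib, Fin.sum_castSucc_lt]
  simp [this]

lemma sum_diagCoeff_mul_of_lt {α β : Fin n} (h : α < β) :
    ∑ k, diagCoeff α k * diagCoeff β k = 0 := by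
  have hk (k : Fin (n + 1)) : diagCoeff α k * diagCoeff β k =
      -(1 / ((n : ℝ) - α.val)) * diagCoeff β k := by
    by_cases hβ : β.castSucc ≤ k
    · have hα : α.castSucc < k := (Fin.castSucc_lt_castSucc_iff.2 h).trans_le hβ
      rw [diagCoeff, if_neg hα.ne', if_pos hα, zero_sub]
    · have : diagCoeff β k = 0 := by
        rw [diagCoeff, if_neg fun h => hβ h.ge, if_neg fun h => hβ h.le, sub_zero]
      rw [this, mul_zero, mul_zero]
  rw [Finset.sum_congr rfl fun k _ => hk k, ← Finset.mul_sum, sum_diagCoeff, mul_zero]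

lemma sum_diagCoeff_mul (α β : Fin n) :
    ∑ k, diagCoeff α k * diagCoeff β k =
      if α = β then ((n : ℝ) - α.val + 1) / (n - α.val) else 0 := by
  rcases lt_trichotomy α β with h | rfl | h
  · rw [sum_diagCoeff_mul_of_lt h, if_neg h.ne]
  · have hk (k : Fin (n + 1)) : diagCoeff α k * diagCoeff α k =
        (if k = α.castSucc then 1 else 0) +
          if α.castSucc < k then (1 / ((n : ℝ) - α.val)) ^ 2 else 0 := by
      unfold diagCoeff
      by_cases h : k = α.castSucc
      · simp [h]
      · split_ifs <;> ring
    have := (sub_val_pos α).ne'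
    rw [Finset.sum_congr rfl fun k _ => hk k, Finset.sum_add_distrib, Fin.sum_castSucc_lt]
    simp only [Finset.sum_ite_eq', Finset.mem_univ, if_true]
    field_simp
  · simp_rw [mul_comm (diagCoeff α _)]
    rw [sum_diagCoeff_mul_of_lt h, if_neg h.ne']

lemma LOd_sq (hn : 1 ≤ n) : LOd n * LOd n = 2 * ((n : ℝ) + 1) / n :=
  Real.mul_self_sqrt (by positivity)

lemma LOc_sq (α : Fin n) : LOc n (α.val + 1) * LOc n (α.val + 1) =
    ((n : ℝ) + 1) * (n - α.val) / (n * (n - α.val + 1)) := by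
  have h := sub_val_pos α
  rw [LOc, Real.mul_self_sqrt]
  · push_cast
    ring_nf
  · push_cast
    have h1 : (n : ℝ) + 1 - (α.val + 1) = n - α.val := by ring
    have h2 : (n : ℝ) + 2 - (α.val + 1) = n - α.val + 1 := by ring
    rw [h1, h2]
    positivity

end DiagCoeff

namespace IsSphereMeasure

variable {n : ℕ} {μ : Measure (Fin (n + 1) → ℍ[ℝ])}

lemma integral_blockForm_mul (hμ : IsSphereMeasure μ)
    (htot : μ Set.univ = ENNReal.ofReal (n * (2 * n + 3)))
    (S T : Matrix (Fin 4) (Fin 4) ℝ) (k l k' l' : Fin (n + 1)) :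
    ∫ a, blockForm S k l a * blockForm T k' l' a ∂μ = (n : ℝ) / (8 * (n + 1)) *
        ((if k = l then 1 else 0) * (if k' = l' then 1 else 0) * (S.trace * T.trace) +
          (if k = k' then 1 else 0) * (if l = l' then 1 else 0) * (S * T.transpose).trace +
          (if k = l' then 1 else 0) * (if l = k' then 1 else 0) * (S * T).trace) := by
  obtain ⟨κ, hκ, h⟩ := hμ.exists_integral_blockForm_mul
  rw [h]
  congr 1
  rw [measureReal_def, htot, ENNReal.toReal_ofReal (by positivity)] at hκ
  push_cast at hκ
  rw [eq_div_iff (by positivity)]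
  have h3 : (2 * n + 3 : ℝ) ≠ 0 := by positivity
  apply mul_right_cancel₀ h3
  linear_combination hκ

lemma integral_pair_mul_pair (hμ : IsSphereMeasure μ) (hn : 1 ≤ n)
    (htot : μ Set.univ = ENNReal.ofReal (n * (2 * n + 3))) (s t : Fin 4)
    (p q : SpherePairs (n + 1)) :
    ∫ a, LOd n * blockForm (starMulMatrix s) p.1.1 p.1.2 a *
      (LOd n * blockForm (starMulMatrix t) q.1.1 q.1.2 a) ∂μ =
      if s = t ∧ p = q then 1 else 0 := by
  simp_rw [mul_mul_mul_comm (LOd n)]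
  rw [integral_const_mul, hμ.integral_blockForm_mul htot, trace_starMulMatrix_mul_transpose,
    LOd_sq hn]
  have hcross : (if p.1.1 = q.1.2 then (1 : ℝ) else 0) * (if p.1.2 = q.1.1 then 1 else 0) = 0 := by
    by_cases h1 : p.1.1 = q.1.2
    · have h2 : p.1.2 ≠ q.1.1 := fun h2 => lt_asymm p.2 (by rw [h1, h2]; exact q.2)
      rw [if_neg h2, mul_zero]
    · rw [if_neg h1, zero_mul]
  have hdiag : (if p.1.1 = q.1.1 then (1 : ℝ) else 0) * (if p.1.2 = q.1.2 then 1 else 0) =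
      if p = q then 1 else 0 := by
    by_cases h : p = q
    · simp [h]
    · have : ¬ (p.1.1 = q.1.1 ∧ p.1.2 = q.1.2) := fun h' => h (Subtype.ext (Prod.ext h'.1 h'.2))
      rw [if_neg h]
      by_cases h1 : p.1.1 = q.1.1 <;> simp_all
  rw [hcross, hdiag, if_neg p.2.ne]
  have : (n : ℝ) ≠ 0 := by positivity
  by_cases hs : s = t <;> by_cases hp : p = q <;> simp [hs, hp]
  field_simp
  norm_num

lemma integral_diag_mul_pair (hμ : IsSphereMeasure μ)
    (htot : μ Set.univ = ENNReal.ofReal (n * (2 * n + 3))) (t : Fin 4) (α : Fin n)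
    (q : SpherePairs (n + 1)) :
    ∫ a, LOc n (α.val + 1) * (∑ k, diagCoeff α k * blockForm 1 k k a) *
      (LOd n * blockForm (starMulMatrix t) q.1.1 q.1.2 a) ∂μ = 0 := by
  simp_rw [mul_mul_mul_comm (LOc n _), Finset.sum_mul, mul_assoc (diagCoeff _ _)]
  rw [integral_const_mul, integral_finsetSum _ fun k _ => hμ.integrable (by fun_prop)]
  refine mul_eq_zero_of_right _ (Finset.sum_eq_zero fun k _ => ?_)
  have h : (if k = q.1.1 then (1 : ℝ) else 0) * (if k = q.1.2 then 1 else 0) = 0 := by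
    by_cases h : k = q.1.1
    · simp [h, q.2.ne]
    · simp [h]
  rw [integral_const_mul, hμ.integral_blockForm_mul htot, h,
    mul_comm (if k = q.1.2 then (1 : ℝ) else 0), h, if_neg q.2.ne]
  simp

lemma integral_diag_mul_diag (hμ : IsSphereMeasure μ) (hn : 1 ≤ n)
    (htot : μ Set.univ = ENNReal.ofReal (n * (2 * n + 3))) (α β : Fin n) :
    ∫ a, LOc n (α.val + 1) * (∑ k, diagCoeff α k * blockForm 1 k k a) *
      (LOc n (β.val + 1) * ∑ k, diagCoeff β k * blockForm 1 k k a) ∂μ =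
      if α = β then 1 else 0 := by
  have hterm (k l : Fin (n + 1)) :
      ∫ a, diagCoeff α k * blockForm 1 k k a * (diagCoeff β l * blockForm 1 l l a) ∂μ =
        2 * (n : ℝ) / (n + 1) * (diagCoeff α k * diagCoeff β l) +
          if k = l then (n : ℝ) / (n + 1) * (diagCoeff α k * diagCoeff β l) else 0 := by
    simp_rw [mul_mul_mul_comm (diagCoeff α k)]
    rw [integral_const_mul, hμ.integral_blockForm_mul htot]
    have : (n : ℝ) + 1 ≠ 0 := by positivity
    by_cases h : k = l <;> simp [h] <;> field_simp <;> ring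
  simp_rw [mul_mul_mul_comm (LOc n _), Finset.sum_mul_sum]
  rw [integral_const_mul, integral_finsetSum _ fun k _ => hμ.integrable (by fun_prop)]
  have hinner (k : Fin (n + 1)) :
      ∫ a, ∑ l, diagCoeff α k * blockForm 1 k k a * (diagCoeff β l * blockForm 1 l l a) ∂μ =
        (n : ℝ) / (n + 1) * (diagCoeff α k * diagCoeff β k) := by
    rw [integral_finsetSum _ fun l _ => hμ.integrable (by fun_prop)]
    simp only [hterm, Finset.sum_add_distrib, ← Finset.mul_sum, sum_diagCoeff, Finset.sum_ite_eq,
      Finset.mem_univ, if_true, mul_zero, zero_add]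
  rw [Finset.sum_congr rfl fun k _ => hinner k, ← Finset.mul_sum, sum_diagCoeff_mul]
  rcases eq_or_ne α β with rfl | h
  · rw [if_pos rfl, if_pos rfl, LOc_sq]
    have h1 := sub_val_pos α
    have h2 : (n : ℝ) - α.val + 1 ≠ 0 := by positivity
    have h3 : (n : ℝ) ≠ 0 := by positivity
    field_simp
  · simp [h]

end IsSphereMeasure

/-- Lemma 3.2. The `n(2n+3)` functions `ψ_α, ψ_{kl}, ψ_{k̄l̄},
ψ̃_{kl}, ψ̃_{k̄l̄}`, restricted to the unit sphere `S^{4n+3} ⊂ ℍ^{n+1}`, form an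
orthonormal system with respect to the `L²` inner product given by the
rotation-invariant Borel measure `μ` on the sphere normalized so that
`μ(S^{4n+3}) = n(2n+3)`. -/
theorem typeII_orthonormal (n : ℕ) (hn : 1 ≤ n)
    (μ : Measure (Fin (n + 1) → ℍ[ℝ]))
    (hsph : μ {a | ∑ k : Fin (n + 1), Quaternion.normSq (a k) ≠ 1} = 0)
    (hinv : ∀ g : (Fin (n + 1) → ℍ[ℝ]) →ₗ[ℝ] (Fin (n + 1) → ℍ[ℝ]),
      (∀ a, ∑ k : Fin (n + 1), Quaternion.normSq (g a k) =
        ∑ k : Fin (n + 1), Quaternion.normSq (a k)) → μ.map g = μ)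
    (htot : μ Set.univ = ENNReal.ofReal (n * (2 * n + 3))) :
    ∀ i j : QFamIdx n,
      ∫ a, qfam n i a * qfam n j a ∂μ = if i = j then 1 else 0 := by
  have hμ : IsSphereMeasure μ := by
    refine ⟨⟨?_⟩, hsph, hinv⟩
    rw [htot]
    exact ENNReal.ofReal_lt_top
  have hAA := hμ.integral_diag_mul_diag hn htot
  have hAP := hμ.integral_diag_mul_pair htot
  have hPP := hμ.integral_pair_mul_pair hn htot
  have hPA (t : Fin 4) (q : SpherePairs (n + 1)) (α : Fin n) :
      ∫ a, LOd n * blockForm (starMulMatrix t) q.1.1 q.1.2 a *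
        (LOc n (α.val + 1) * (∑ k, diagCoeff α k * blockForm 1 k k a)) ∂μ = 0 := by
    simpa only [mul_comm] using hAP t α q
  rintro (α | p | p | p | p) (β | q | q | q | q) <;>
    simp only [qfam, psiA_eq, psiU_eq, psiUbar_eq, psiW_eq, psiWbar_eq, hAA, hAP, hPA, hPP] <;>
    simp
end

section
/- The type-II Lawson–Osserman map F' : ℍ^{n+1} → ℝ^{2n²+7n+4} defined by F'(a) = ( ã_n·(the 4n+4 real coordinates of a), b̃_n·(ψ_α(a); ψ_{kl}(a); ψ_{k̄l̄}(a); ψ̃_{kl}(a); ψ̃_{k̄l̄}(a)) ) sends the unit sphere S^{4n+3} ⊂ ℍ^{n+1} into the unit sphere S^{2n²+7n+3} ⊂ ℝ^{2n²+7n+4}: if Σ_{k=1}^{n+1} |a_k|² = 1 then the Euclidean norm of F'(a) equals 1. -/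
open scoped BigOperators Quaternion

/-- The constant `ã_n`. -/
noncomputable def LOat (n : ℕ) : ℝ :=
  Real.sqrt (6 * ((n : ℝ) + 1) / (((n : ℝ) + 2) * (4 * n + 3)))

/-- The constant `b̃_n`. -/
noncomputable def LObt (n : ℕ) : ℝ :=
  Real.sqrt ((n : ℝ) * (4 * n + 5) / (((n : ℝ) + 2) * (4 * n + 3)))

/-- The four real coordinates of a quaternion. -/
def quatCoord (q : ℍ[ℝ]) : Fin 4 → ℝ := ![q.re, q.imI, q.imJ, q.imK]

/-- Index type for `ℝ^{2n²+7n+4} = ℝ^{4n+4} × ℝ^{n(2n+3)}`. -/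
abbrev BIdxII (n : ℕ) := (Fin (n + 1) × Fin 4) ⊕ QFamIdx n

/-- The type-II Lawson–Osserman map `F'`. -/
noncomputable def LOFII (n : ℕ) (a : Fin (n + 1) → ℍ[ℝ]) : EuclideanSpace ℝ (BIdxII n) :=
  (WithLp.equiv 2 (BIdxII n → ℝ)).symm fun i =>
    match i with
    | Sum.inl (k, j) => LOat n * quatCoord (a k) j
    | Sum.inr j => LObt n * qfam n j a

/-- The Helmert decomposition of the sum of squared deviations from the mean. -/
lemma sum_helmert_sq (n : ℕ) (x : Fin (n + 1) → ℝ) :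
    ∑ α : Fin n, ((n : ℝ) - α.val) / ((n : ℝ) + 1 - α.val) *
      (x α.castSucc - (1 / ((n : ℝ) - α.val)) *
        ∑ k : Fin (n + 1), if (α.val : ℕ) < k.val then x k else 0) ^ 2 =
      ∑ k, x k ^ 2 - (∑ k, x k) ^ 2 / ((n : ℝ) + 1) := by
  induction n with
  | zero => simp
  | succ n ih =>
    have h := ih fun k => x k.succ
    rw [Fin.sum_univ_succ, Fin.sum_univ_succ (fun k => x k ^ 2), Fin.sum_univ_succ x]
    have hterm (α : Fin n) :
        (((n + 1 : ℕ) : ℝ) - α.succ.val) / (((n + 1 : ℕ) : ℝ) + 1 - α.succ.val) *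
          (x α.succ.castSucc - (1 / (((n + 1 : ℕ) : ℝ) - α.succ.val)) *
            ∑ k : Fin (n + 1 + 1), if (α.succ.val : ℕ) < k.val then x k else 0) ^ 2 =
        ((n : ℝ) - α.val) / ((n : ℝ) + 1 - α.val) *
          (x α.castSucc.succ - (1 / ((n : ℝ) - α.val)) *
            ∑ k : Fin (n + 1), if (α.val : ℕ) < k.val then x k.succ else 0) ^ 2 := by
      have h1 : ((n + 1 : ℕ) : ℝ) - α.succ.val = (n : ℝ) - α.val := by
        push_cast [Fin.val_succ]; ring
      have h2 : ((n + 1 : ℕ) : ℝ) + 1 - α.succ.val = (n : ℝ) + 1 - α.val := by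
        push_cast [Fin.val_succ]; ring
      rw [h1, h2, Fin.sum_univ_succ, Fin.succ_castSucc]
      simp
    rw [Finset.sum_congr rfl fun α _ => hterm α, h, Fin.sum_univ_succ]
    have hpos : (n : ℝ) + 1 ≠ 0 := by positivity
    have hpos' : (n : ℝ) + 1 + 1 ≠ 0 := by positivity
    simp only [Fin.val_zero, Fin.val_succ, lt_irrefl, if_false, Nat.succ_pos, if_true,
      Fin.castSucc_zero, Nat.cast_zero, sub_zero, zero_add, Nat.cast_add, Nat.cast_one]
    field_simp
    ring

lemma two_mul_sum_spherePairs (m : ℕ) (x : Fin m → ℝ) :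
    2 * ∑ p : SpherePairs m, x p.1.1 * x p.1.2 = (∑ k, x k) ^ 2 - ∑ k, x k ^ 2 := by
  have hpairs : ∑ p : SpherePairs m, x p.1.1 * x p.1.2 =
      ∑ k, ∑ l, if k < l then x k * x l else 0 := by
    rw [← Fintype.sum_prod_type' (f := fun k l => if k < l then x k * x l else 0),
      ← Finset.sum_filter]
    exact (Finset.sum_subtype _ (by simp) fun p : Fin m × Fin m => x p.1 * x p.2).symm
  have hswap : ∑ k, ∑ l, (if k < l then x k * x l else 0) =
      ∑ k, ∑ l, if l < k then x k * x l else 0 := by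
    rw [Finset.sum_comm]
    simp only [mul_comm]
  have hdiag : ∑ k, x k ^ 2 = ∑ k, ∑ l, if k = l then x k * x l else 0 := by
    simp [sq]
  rw [hpairs, two_mul]
  nth_rewrite 2 [hswap]
  rw [hdiag, sq, Finset.sum_mul_sum, eq_sub_iff_add_eq]
  simp only [← Finset.sum_add_distrib]
  refine Finset.sum_congr rfl fun k _ => Finset.sum_congr rfl fun l _ => ?_
  rcases lt_trichotomy k l with h | h | h
  · simp [h, h.not_gt, h.ne]
  · simp [h]
  · simp [h, h.not_gt, h.ne']

lemma sum_quatCoord_sq (q : ℍ[ℝ]) : ∑ j, quatCoord q j ^ 2 = Quaternion.normSq q := by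
  simp [quatCoord, Fin.sum_univ_four, Quaternion.normSq_def']

lemma sum_psiA_sq (n : ℕ) (a : Fin (n + 1) → ℍ[ℝ]) :
    ∑ α, psiA n α a ^ 2 = ((n : ℝ) + 1) / n *
      (∑ k, Quaternion.normSq (a k) ^ 2 -
        (∑ k, Quaternion.normSq (a k)) ^ 2 / ((n : ℝ) + 1)) := by
  rw [← sum_helmert_sq n fun k => Quaternion.normSq (a k), Finset.mul_sum]
  refine Finset.sum_congr rfl fun α _ => ?_
  have hα : 0 < (n : ℝ) - α.val := sub_pos.2 (by exact_mod_cast α.isLt)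
  have h1 : (n : ℝ) + 1 - ((α.val + 1 : ℕ) : ℝ) = (n : ℝ) - α.val := by push_cast; ring
  have h2 : (n : ℝ) + 2 - ((α.val + 1 : ℕ) : ℝ) = (n : ℝ) + 1 - α.val := by push_cast; ring
  have hα' : 0 < (n : ℝ) + 1 - α.val := by linarith
  rw [psiA, mul_pow, LOc, h1, h2, Real.sq_sqrt (by positivity), mul_div_mul_comm, mul_assoc]

lemma sum_psi_pair_sq (n : ℕ) (p : SpherePairs (n + 1)) (a : Fin (n + 1) → ℍ[ℝ]) :
    psiU n p a ^ 2 + psiUbar n p a ^ 2 + psiW n p a ^ 2 + psiWbar n p a ^ 2 =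
      2 * ((n : ℝ) + 1) / n * (Quaternion.normSq (a p.1.1) * Quaternion.normSq (a p.1.2)) := by
  rw [← Quaternion.normSq_star (a p.1.1), ← map_mul, Quaternion.normSq_def']
  simp only [psiU, psiUbar, psiW, psiWbar, mul_pow]
  rw [LOd, Real.sq_sqrt (by positivity)]
  ring

/-- The family `qfam` maps the unit sphere into the unit sphere. -/
lemma sum_qfam_sq (n : ℕ) (hn : 1 ≤ n) (a : Fin (n + 1) → ℍ[ℝ])
    (ha : ∑ k, Quaternion.normSq (a k) = 1) : ∑ i, qfam n i a ^ 2 = 1 := by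
  have hn0 : (n : ℝ) ≠ 0 := by positivity
  have hpair := Finset.sum_congr rfl fun p (_ : p ∈ Finset.univ) => sum_psi_pair_sq n p a
  simp only [Finset.sum_add_distrib, ← Finset.mul_sum] at hpair
  have hsq := two_mul_sum_spherePairs (n + 1) fun k => Quaternion.normSq (a k)
  have hA := sum_psiA_sq n a
  simp only [ha] at hsq hA
  have hqfam : ∑ i, qfam n i a ^ 2 = ∑ α, psiA n α a ^ 2 +
      (∑ p, psiU n p a ^ 2 + ∑ p, psiUbar n p a ^ 2 + ∑ p, psiW n p a ^ 2 +
        ∑ p, psiWbar n p a ^ 2) := by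
    simp only [Fintype.sum_sum_type, qfam, add_assoc]
  rw [hqfam, hpair, hA, mul_comm 2 ((n : ℝ) + 1), mul_div_right_comm, mul_assoc, hsq]
  field_simp
  ring

/-- The type-II Lawson–Osserman map `F'` sends the unit sphere
`S^{4n+3} ⊂ ℍ^{n+1}` into the unit sphere `S^{2n²+7n+3} ⊂ ℝ^{2n²+7n+4}`. -/
theorem typeII_LO_sphere_to_sphere (n : ℕ) (hn : 1 ≤ n)
    (a : Fin (n + 1) → ℍ[ℝ])
    (ha : ∑ k : Fin (n + 1), Quaternion.normSq (a k) = 1) :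
    ‖LOFII n a‖ = 1 := by
  have hn0 : (n : ℝ) ≠ 0 := by positivity
  rw [EuclideanSpace.norm_eq, Real.sqrt_eq_one]
  simp only [Real.norm_eq_abs, sq_abs, LOFII, WithLp.equiv_symm_apply, Fintype.sum_sum_type,
    mul_pow, ← Finset.mul_sum]
  have hcoord : ∑ p : Fin (n + 1) × Fin 4, quatCoord (a p.1) p.2 ^ 2 = 1 := by
    rw [Fintype.sum_prod_type, ← ha]
    exact Finset.sum_congr rfl fun k _ => sum_quatCoord_sq (a k)
  have hq := sum_qfam_sq n hn a ha
  simp only [Fintype.sum_sum_type] at hq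
  rw [hcoord, hq, LOat, LObt, Real.sq_sqrt (by positivity), Real.sq_sqrt (by positivity)]
  field_simp
  ring
end
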